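/- arXiv:2604.22463 — 4 statements merged into one kernel-verified Lean document; each statement's English description precedes it below -/
import Mathlib

section
/- Let N ≥ 1, let L_N be the N×N lower-triangular all-ones matrix, and let Λ be the N×N real symmetric tridiagonal matrix with diagonal entries Λ_{i,i} = 2 for 1 ≤ i ≤ N−1 and Λ_{N,N} = 1, off-diagonal entries Λ_{i,i+1} = Λ_{i+1,i} = −1 for 1 ≤ i ≤ N−1, and all other entries zero. Then L_N is invertible, Λ = (L_N⁻¹)ᵀ L_N⁻¹, and the eigenvalues of Λ are exactly the N numbers λ_k = 2 + 2·cos(2kπ/(2N+1)) for k = 1, …, N. -/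
open Matrix

/-- The `N × N` lower-triangular all-ones matrix. -/
def lowerOnes (N : ℕ) : Matrix (Fin N) (Fin N) ℝ :=
  Matrix.of fun i j => if j ≤ i then 1 else 0

/-- The symmetric tridiagonal matrix with diagonal `2, …, 2, 1` and off-diagonal `-1`. -/
def tridiagLambda (N : ℕ) : Matrix (Fin N) (Fin N) ℝ :=
  Matrix.of fun i j =>
    if i = j then (if (i : ℕ) = N - 1 then 1 else 2)
    else if (i : ℕ) + 1 = (j : ℕ) ∨ (j : ℕ) + 1 = (i : ℕ) then -1 else 0

lemma aux_sum (N m : ℕ) (f : ℕ → ℝ) :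
    ∑ k : Fin N, (if (k : ℕ) = m then f k else 0) = if m < N then f m else 0 := by
  rw [Fin.sum_univ_eq_sum_range (fun k => if k = m then f k else 0) N]
  rw [Finset.sum_ite_eq']
  simp

lemma aux_sum' (N m : ℕ) (f : ℕ → ℝ) :
    ∑ k : Fin N, (if (k : ℕ) + 1 = m then f k else 0)
      = if 0 < m ∧ m - 1 < N then f (m - 1) else 0 := by
  rcases m with _ | m
  · simp
  · simpa using aux_sum N m f

def diffMat (N : ℕ) : Matrix (Fin N) (Fin N) ℝ :=
  Matrix.of fun i j => (if (j : ℕ) = i then 1 else 0) - (if (j : ℕ) + 1 = i then 1 else 0)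

lemma diff_mul (N : ℕ) : diffMat N * lowerOnes N = 1 := by
  ext i j
  obtain ⟨F, hF⟩ : ∃ F : ℕ → ℝ, ∀ k, F k = if (j : ℕ) ≤ k then (1 : ℝ) else 0 :=
    ⟨_, fun _ => rfl⟩
  have h : (diffMat N * lowerOnes N) i j =
      ∑ k : Fin N, (if (k : ℕ) = i then F k else 0)
      - ∑ k : Fin N, (if (k : ℕ) + 1 = i then
          F k else 0) := by
    rw [Matrix.mul_apply, ← Finset.sum_sub_distrib]
    refine Finset.sum_congr rfl fun k _ => ?_
    simp only [hF, diffMat, lowerOnes, Matrix.of_apply, Fin.le_def]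
    split_ifs <;> simp
  rw [h, aux_sum, aux_sum', Matrix.one_apply]
  simp only [hF]
  have hi := i.2
  have hj := j.2
  simp only [Fin.ext_iff]
  split_ifs <;> first | (exfalso; omega) | norm_num

lemma diff_tr (N : ℕ) : tridiagLambda N = (diffMat N)ᵀ * diffMat N := by
  ext i j
  obtain ⟨F, hF⟩ : ∃ F : ℕ → ℝ, ∀ k, F k = (if (j : ℕ) = k then (1 : ℝ) else 0)
        - (if (j : ℕ) + 1 = k then 1 else 0) :=
    ⟨_, fun _ => rfl⟩
  have h : ((diffMat N)ᵀ * diffMat N) i j =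
      ∑ k : Fin N, (if (k : ℕ) = i then F k else 0)
      - ∑ k : Fin N, (if (k : ℕ) = i + 1 then F k else 0) := by
    rw [Matrix.mul_apply, ← Finset.sum_sub_distrib]
    refine Finset.sum_congr rfl fun k _ => ?_
    simp only [hF, diffMat, Matrix.of_apply, Matrix.transpose_apply]
    rw [sub_mul]
    simp only [eq_comm (a := (k : ℕ)), ite_mul, one_mul, zero_mul]
  rw [h, aux_sum, aux_sum]
  simp only [hF]
  have hi := i.2
  have hj := j.2
  simp only [tridiagLambda, Matrix.of_apply, Fin.ext_iff]
  split_ifs <;> first | (exfalso; omega) | norm_num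

lemma tri_mulVec (N : ℕ) (f : ℕ → ℝ) (h0 : f 0 = 0) (h1 : f (N + 1) = f N) (i : Fin N) :
    (tridiagLambda N).mulVec (fun j : Fin N => f (j + 1)) i
      = 2 * f (i + 1) - f i - f (i + 2) := by
  have hi := i.2
  obtain ⟨F, hF⟩ : ∃ F : ℕ → ℝ, ∀ k, F k = f (k + 1) :=
    ⟨_, fun _ => rfl⟩
  obtain ⟨G, hG⟩ : ∃ G : ℕ → ℝ, ∀ k, G k = (if (i : ℕ) = N - 1 then 1 else 2) * f (k + 1) :=
    ⟨_, fun _ => rfl⟩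
  have h : (tridiagLambda N).mulVec (fun j : Fin N => f (j + 1)) i =
      ∑ k : Fin N, (if (k : ℕ) = i then
          G k else 0)
      - ∑ k : Fin N, (if (k : ℕ) = i + 1 then F k else 0)
      - ∑ k : Fin N, (if (k : ℕ) + 1 = i then F k else 0) := by
    rw [Matrix.mulVec, dotProduct, ← Finset.sum_sub_distrib, ← Finset.sum_sub_distrib]
    refine Finset.sum_congr rfl fun k _ => ?_
    simp only [hF, hG, tridiagLambda, Matrix.of_apply, Fin.ext_iff]
    split_ifs <;> first | (exfalso; omega) | simp
  rw [h, aux_sum, aux_sum, aux_sum']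
  simp only [hF, hG]
  have e1 : (if 0 < (i : ℕ) ∧ (i : ℕ) - 1 < N then f ((i : ℕ) - 1 + 1) else 0) = f i := by
    rcases Nat.eq_zero_or_pos (i : ℕ) with h | h
    · simp [h, h0]
    · rw [if_pos ⟨h, by omega⟩, Nat.sub_add_cancel h]
  simp only [e1, hi, if_true]
  by_cases hl : (i : ℕ) = N - 1
  · have e2 : (i : ℕ) + 1 = N := by omega
    have e3 : (i : ℕ) + 2 = N + 1 := by omega
    rw [if_pos hl, e3, h1, e2]
    simp
    ring
  · rw [if_neg hl, if_pos (by omega)]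
    ring

lemma tri_eig (N k : ℕ) (hk : 1 ≤ k) (hkN : k ≤ N) :
    ∃ v : Fin N → ℝ, v ≠ 0 ∧ (tridiagLambda N).mulVec v
      = (2 + 2 * Real.cos (2 * k * Real.pi / (2 * N + 1))) • v := by
  set θ : ℝ := 2 * k * Real.pi / (2 * N + 1) with hθ
  have hN : (0 : ℝ) < 2 * N + 1 := by positivity
  have hk' : (1 : ℝ) ≤ k := by exact_mod_cast hk
  have hkN' : (k : ℝ) ≤ N := by exact_mod_cast hkN
  have hpi := Real.pi_pos
  have hmul : θ * (2 * N + 1) = k * (2 * Real.pi) := by rw [hθ]; field_simp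
  have hs : 0 < Real.sin θ := by
    apply Real.sin_pos_of_pos_of_lt_pi
    · positivity
    · rw [hθ, div_lt_iff₀ hN]; nlinarith
  let f : ℕ → ℝ := fun j => (-1) ^ j * Real.sin (j * θ)
  refine ⟨fun j => f (j + 1), ?_, ?_⟩
  · intro h
    have := congrFun h ⟨0, by omega⟩
    simp [f] at this
    exact hs.ne' this
  · ext i
    rw [tri_mulVec N f (by simp [f])]
    · simp only [f, Pi.smul_apply, smul_eq_mul]
      push_cast
      have a : ((i : ℕ) + 2 : ℝ) * θ = ((i : ℕ) + 1) * θ + θ := by ring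
      have b : ((i : ℕ) : ℝ) * θ = ((i : ℕ) + 1) * θ - θ := by ring
      rw [a, b, Real.sin_add, Real.sin_sub]
      ring
    · simp only [f]
      push_cast
      have a : ((N : ℝ) + 1) * θ = k * (2 * Real.pi) - N * θ := by linarith
      rw [a, Real.sin_nat_mul_two_pi_sub]
      ring

lemma root_iff (N : ℕ) (μ : ℝ) :
    (∃ v : Fin N → ℝ, v ≠ 0 ∧ (tridiagLambda N).mulVec v = μ • v)
      ↔ μ ∈ (tridiagLambda N).charpoly.roots.toFinset := by
  rw [Multiset.mem_toFinset, Polynomial.mem_roots (Matrix.charpoly_monic _).ne_zero,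
    Polynomial.IsRoot, Matrix.eval_charpoly, ← Matrix.exists_mulVec_eq_zero_iff]
  refine exists_congr fun v => and_congr_right fun _ => ?_
  rw [Matrix.sub_mulVec, sub_eq_zero, Matrix.scalar_apply, ← Matrix.smul_one_eq_diagonal,
    Matrix.smul_mulVec, Matrix.one_mulVec, eq_comm]

theorem stmt_5 (N : ℕ) (hN : 1 ≤ N) :
    IsUnit (lowerOnes N) ∧
    tridiagLambda N = ((lowerOnes N)⁻¹)ᵀ * (lowerOnes N)⁻¹ ∧
    {μ : ℝ | ∃ v : Fin N → ℝ, v ≠ 0 ∧ (tridiagLambda N).mulVec v = μ • v} =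
      {μ : ℝ | ∃ k : ℕ, 1 ≤ k ∧ k ≤ N ∧
        μ = 2 + 2 * Real.cos (2 * k * Real.pi / (2 * N + 1))} := by
  refine ⟨.of_mul_eq_one_right _ (diff_mul N), ?_, ?_⟩
  · rw [Matrix.inv_eq_left_inv (diff_mul N)]
    exact diff_tr N
  · let g : ℕ → ℝ := fun k => 2 + 2 * Real.cos (2 * k * Real.pi / (2 * N + 1))
    have hinj : Set.InjOn g (Finset.Icc 1 N : Finset ℕ) := by
      intro a ha b hb hab
      have hN0 : (0 : ℝ) < 2 * N + 1 := by positivity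
      have hpi := Real.pi_pos
      have key : ∀ a ∈ (Finset.Icc 1 N : Finset ℕ),
          (2 * a * Real.pi / (2 * N + 1) : ℝ) ∈ Set.Icc 0 Real.pi := by
        intro a ha
        have h : (a : ℝ) ≤ N := by exact_mod_cast (Finset.mem_Icc.1 ha).2
        refine ⟨by positivity, ?_⟩
        rw [div_le_iff₀ hN0]; nlinarith
      have h := Real.injOn_cos (key a ha) (key b hb) (by simp only [g] at hab; linarith)
      field_simp at h
      exact_mod_cast h
    have hsub : (Finset.Icc 1 N).image g ⊆ (tridiagLambda N).charpoly.roots.toFinset := by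
      intro μ hμ
      obtain ⟨k, hk, rfl⟩ := Finset.mem_image.1 hμ
      rw [Finset.mem_Icc] at hk
      exact (root_iff N _).1 (tri_eig N k hk.1 hk.2)
    have heq := Finset.eq_of_subset_of_card_le hsub (by
      rw [Finset.card_image_of_injOn hinj, Nat.card_Icc]
      refine (Multiset.toFinset_card_le _).trans ((Polynomial.card_roots' _).trans ?_)
      rw [Matrix.charpoly_natDegree_eq_dim]
      simp)
    ext μ
    rw [Set.mem_ofPred_eq, root_iff, ← heq, Finset.mem_image]
    simp only [Finset.mem_Icc, Set.mem_ofPred_eq, g, and_assoc, eq_comm]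
end

section
/- Define f(N) := 2 + 2·cos(2Nπ/(2N+1)). Then for every natural number N ≥ 1, (2/π)·N ≤ 1/√(f(N)) ≤ N. -/
theorem stmt_6 (N : ℕ) (hN : 1 ≤ N) :
    (2 / Real.pi) * N ≤
      1 / Real.sqrt (2 + 2 * Real.cos (2 * N * Real.pi / (2 * N + 1))) ∧
    1 / Real.sqrt (2 + 2 * Real.cos (2 * N * Real.pi / (2 * N + 1))) ≤ N := by
  have hn : (1 : ℝ) ≤ N := by exact_mod_cast hN
  generalize (N : ℝ) = n at hn
  have hpi := Real.pi_pos
  have hd : 0 < 2 * n + 1 := by linarith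
  obtain ⟨x, hx⟩ : ∃ x, x = Real.pi / (2 * (2 * n + 1)) := ⟨_, rfl⟩
  have hx0 : 0 < x := by rw [hx]; positivity
  have ht1 : 3 / (2 * n + 1) ≤ 1 := by rw [div_le_one hd]; linarith
  have ht0 : 0 ≤ 3 / (2 * n + 1) := by positivity
  have hs : 3 / (2 * n + 1) * (1 / 2) ≤ Real.sin x := by
    have h := strictConcaveOn_sin_Icc.concaveOn.2
      (x := Real.pi / 6) (y := 0) ⟨by linarith, by linarith⟩ ⟨le_refl _, by linarith⟩
      ht0 (sub_nonneg.2 ht1) (by ring)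
    simp only [smul_eq_mul, Real.sin_pi_div_six, Real.sin_zero, mul_zero, add_zero] at h
    have e : x = 3 / (2 * n + 1) * (Real.pi / 6) := by rw [hx]; field_simp; norm_num
    rw [e]; exact h
  have hs0 : 0 < Real.sin x := lt_of_lt_of_le (by positivity) hs
  have hsq : Real.sqrt (2 + 2 * Real.cos (2 * n * Real.pi / (2 * n + 1))) = 2 * Real.sin x := by
    have e : 2 * n * Real.pi / (2 * n + 1) = Real.pi - 2 * x := by
      rw [hx]; field_simp; ring
    rw [e, Real.cos_pi_sub, Real.cos_two_mul, Real.cos_sq']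
    rw [show 2 + 2 * -(2 * (1 - Real.sin x ^ 2) - 1) = (2 * Real.sin x) ^ 2 by ring]
    exact Real.sqrt_sq (by positivity)
  rw [hsq]
  constructor
  · rw [le_div_iff₀ (by positivity)]
    have h1 : Real.sin x ≤ x := Real.sin_le hx0.le
    calc 2 / Real.pi * n * (2 * Real.sin x) ≤ 2 / Real.pi * n * (2 * x) := by gcongr
      _ = 2 * n / (2 * n + 1) := by rw [hx]; field_simp
      _ ≤ 1 := by rw [div_le_one hd]; linarith
  · rw [div_le_iff₀ (by positivity)]
    calc 1 ≤ n * (2 * (3 / (2 * n + 1) * (1 / 2))) := by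
          rw [show n * (2 * (3 / (2 * n + 1) * (1 / 2))) = 3 * n / (2 * n + 1) by field_simp,
            le_div_iff₀ hd]; linarith
      _ ≤ n * (2 * Real.sin x) := by gcongr
end

section
/- For every H ∈ (0,1) and every real x ≥ 1, ∫₀¹ 2H·(x−t)^{H−1/2}·(1−t)^{H−1/2} dt = (2H/(1/2 + H)) · (1/x)^{1/2−H} · Σ_{n=0}^∞ [ ((1/2−H)_n · (1)_n / (3/2+H)_n ) · (1/x)^n / n! ], where the series on the right converges. -/
open MeasureTheory

lemma aux_binom (a y : ℝ) (hy0 : 0 ≤ y) (hy : y < 1) :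
    HasSum (fun n : ℕ => (ascPochhammer ℝ n).eval a / (Nat.factorial n : ℝ) * y ^ n)
      ((1 - y) ^ (-a)) := by
  have h := Real.one_div_one_sub_rpow_hasFPowerSeriesOnBall_zero a
  have hy' : y ∈ Metric.eball (0 : ℝ) 1 := by
    simp only [Metric.mem_eball, edist_zero_right]
    rw [← ofReal_norm, Real.norm_of_nonneg hy0]
    simpa using hy
  have h2 := h.hasSum hy'
  rw [zero_add, one_div, ← Real.rpow_neg (by linarith)] at h2
  suffices h5 : (fun n : ℕ => (ascPochhammer ℝ n).eval a / (Nat.factorial n : ℝ) * y ^ n) =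
      fun n => (FormalMultilinearSeries.ofScalars ℝ (fun n : ℕ => Ring.choose (a + n - 1) n) n)
        fun _ => y by
    rw [h5]; exact h2
  funext n
  rw [FormalMultilinearSeries.ofScalars_apply_eq, smul_eq_mul]
  congr 1
  have h3 := Ring.factorial_nsmul_multichoose_eq_ascPochhammer a n
  have h4 : Ring.choose (a + n - 1) n = Ring.multichoose a n := by
    rw [Ring.choose]; congr 1; ring
  rw [h4, div_eq_iff (by positivity), mul_comm, ← nsmul_eq_mul, h3,
    Polynomial.ascPochhammer_smeval_eq_eval]

lemma aux_int (s : ℝ) (hs : 0 < s) (n : ℕ) :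
    IntervalIntegrable (fun t : ℝ => t ^ n * (1 - t) ^ (s - 1)) volume 0 1 := by
  have h : IntervalIntegrable (fun t : ℝ => t ^ (s - 1)) volume 0 1 :=
    intervalIntegral.intervalIntegrable_rpow' (by linarith)
  have h2 := (h.comp_sub_left 1).symm
  simp only [sub_self, sub_zero] at h2
  exact h2.continuousOn_mul (by fun_prop)

lemma aux_prod (s : ℝ) (n : ℕ) :
    ∏ j ∈ Finset.range (n + 1), (s + j) = s * (ascPochhammer ℝ n).eval (s + 1) := by
  induction n with
  | zero => simp
  | succ k ih =>
    rw [Finset.prod_range_succ, ih, ascPochhammer_succ_eval]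
    push_cast; ring

lemma aux_mom (s : ℝ) (hs : 0 < s) (n : ℕ) :
    (∫ t in (0:ℝ)..1, t ^ n * (1 - t) ^ (s - 1)) =
      (Nat.factorial n : ℝ) / (s * (ascPochhammer ℝ n).eval (s + 1)) := by
  have h := Complex.betaIntegral_eval_nat_add_one_right (u := (s : ℂ)) (by simpa using hs) n
  rw [← Complex.betaIntegral_symm, Complex.betaIntegral] at h
  have h2 : (∫ t in (0:ℝ)..1, (t : ℂ) ^ ((n + 1 : ℂ) - 1) * (1 - (t : ℂ)) ^ ((s : ℂ) - 1)) =
      ∫ t in (0:ℝ)..1, ((t ^ n * (1 - t) ^ (s - 1) : ℝ) : ℂ) := by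
    apply intervalIntegral.integral_congr
    intro t ht
    rw [Set.uIcc_of_le zero_le_one] at ht
    simp only [add_sub_cancel_right, Complex.cpow_natCast]
    push_cast
    rw [Complex.ofReal_cpow (by linarith [ht.2])]
    push_cast
    rfl
  rw [h2, intervalIntegral.integral_ofReal] at h
  rw [← aux_prod]
  apply Complex.ofReal_injective
  rw [h]
  push_cast
  rfl

lemma aux_sum_s14 (a c : ℝ) (ha : -1 < a) (hc : 0 < c) (hac : a + 1 < c) :
    Summable (fun n : ℕ => |(ascPochhammer ℝ n).eval a| / (ascPochhammer ℝ n).eval c) := by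
  rw [← summable_nat_add_iff 1]
  set u : ℕ → ℝ := fun n => |(ascPochhammer ℝ (n+1)).eval a| / (ascPochhammer ℝ (n+1)).eval c
    with hu
  have hP : ∀ n, 0 < (ascPochhammer ℝ n).eval c := fun n => ascPochhammer_pos n c hc
  have hu0 : ∀ n, 0 ≤ u n := fun n => div_nonneg (abs_nonneg _) (hP _).le
  have hrec : ∀ n : ℕ, u (n+1) * (c + (n + 1)) = u n * (a + (n + 1)) := by
    intro n
    have h1 : (0:ℝ) < a + (n + 1) := by
      have : (0:ℝ) ≤ n := n.cast_nonneg
      linarith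
    have h2 : (0:ℝ) < c + (n + 1) := by positivity
    have h3 := hP (n+1)
    simp only [hu]
    rw [ascPochhammer_succ_eval (n+1) a, ascPochhammer_succ_eval (n+1) c, abs_mul]
    push_cast
    rw [abs_of_pos h1]
    field_simp
  have key : ∀ N : ℕ, (c - a - 1) * ∑ i ∈ Finset.range N, u i = c * u 0 - (c + N) * u N := by
    intro N
    induction N with
    | zero => simp
    | succ k ih =>
      rw [Finset.sum_range_succ, mul_add, ih]
      push_cast
      linarith [hrec k]
  apply summable_of_sum_range_le (c := c * u 0 / (c - a - 1)) hu0
  intro N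
  rw [le_div_iff₀ (by linarith), mul_comm, key]
  have : 0 ≤ (c + N) * u N := mul_nonneg (by positivity) (hu0 N)
  linarith

theorem stmt_14 (H : ℝ) (hH : H ∈ Set.Ioo (0 : ℝ) 1) (x : ℝ) (hx : 1 ≤ x) :
    Summable (fun n : ℕ =>
      (ascPochhammer ℝ n).eval (1 / 2 - H) * (ascPochhammer ℝ n).eval 1 /
          (ascPochhammer ℝ n).eval (3 / 2 + H) *
        (1 / x) ^ n / (Nat.factorial n : ℝ)) ∧
    (∫ t in (0 : ℝ)..1, 2 * H * (x - t) ^ (H - 1 / 2) * (1 - t) ^ (H - 1 / 2)) =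
      2 * H / (1 / 2 + H) * (1 / x) ^ ((1 : ℝ) / 2 - H) *
        ∑' n : ℕ,
          (ascPochhammer ℝ n).eval (1 / 2 - H) * (ascPochhammer ℝ n).eval 1 /
              (ascPochhammer ℝ n).eval (3 / 2 + H) *
            (1 / x) ^ n / (Nat.factorial n : ℝ) := by
  obtain ⟨hH0, hH1⟩ := hH
  have hx0 : 0 < x := by linarith
  have hs : 0 < H + 1 / 2 := by linarith
  have hterm : ∀ n : ℕ, (ascPochhammer ℝ n).eval (1 / 2 - H) * (ascPochhammer ℝ n).eval 1 /
          (ascPochhammer ℝ n).eval (3 / 2 + H) * (1 / x) ^ n / (Nat.factorial n : ℝ) =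
        (ascPochhammer ℝ n).eval (1 / 2 - H) / (ascPochhammer ℝ n).eval (3 / 2 + H)
          * (1 / x) ^ n := by
    intro n
    rw [ascPochhammer_eval_one]
    have : (Nat.factorial n : ℝ) ≠ 0 := by positivity
    field_simp
  simp only [hterm]
  have hP : ∀ n, 0 < (ascPochhammer ℝ n).eval (3 / 2 + H) :=
    fun n => ascPochhammer_pos n _ (by linarith)
  have hS := aux_sum_s14 (1 / 2 - H) (3 / 2 + H) (by linarith) (by linarith) (by linarith)
  have hx1 : 0 ≤ 1 / x := by positivity
  have hx2 : 1 / x ≤ 1 := by rw [div_le_one hx0]; exact hx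
  have hS2 : Summable (fun n : ℕ => |(ascPochhammer ℝ n).eval (1 / 2 - H)| /
      (ascPochhammer ℝ n).eval (3 / 2 + H) * (1 / x) ^ n) := by
    refine Summable.of_nonneg_of_le (fun n => ?_) (fun n => ?_) hS
    · exact mul_nonneg (div_nonneg (abs_nonneg _) (hP n).le) (by positivity)
    · exact mul_le_of_le_one_right (div_nonneg (abs_nonneg _) (hP n).le) (pow_le_one₀ hx1 hx2)
  refine ⟨?_, ?_⟩
  · refine Summable.of_norm ?_
    refine hS2.congr (fun n => ?_)
    rw [norm_mul, norm_div, Real.norm_eq_abs, Real.norm_of_nonneg (hP n).le,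
      Real.norm_of_nonneg (by positivity)]
  set A : ℕ → ℝ := fun n => (ascPochhammer ℝ n).eval (1 / 2 - H) with hA
  set F : ℕ → ℝ → ℝ := fun n t =>
    (A n / (Nat.factorial n : ℝ) * (1 / x) ^ n) * (t ^ n * (1 - t) ^ (H + 1 / 2 - 1)) with hF
  have hmom : ∀ n : ℕ, (∫ t in Set.Ioo (0:ℝ) 1, t ^ n * (1 - t) ^ (H + 1 / 2 - 1)) =
      (Nat.factorial n : ℝ) / ((H + 1 / 2) * (ascPochhammer ℝ n).eval (3 / 2 + H)) := by
    intro n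
    have := aux_mom (H + 1 / 2) hs n
    rw [intervalIntegral.integral_of_le zero_le_one, integral_Ioc_eq_integral_Ioo] at this
    rw [this, show H + 1 / 2 + 1 = 3 / 2 + H by ring]
  have hint : ∀ n, Integrable (F n) (volume.restrict (Set.Ioo (0:ℝ) 1)) := by
    intro n
    have := aux_int (H + 1 / 2) hs n
    rw [intervalIntegrable_iff_integrableOn_Ioo_of_le zero_le_one] at this
    exact this.const_mul _
  have hnorm : ∀ n, (∫ t in Set.Ioo (0:ℝ) 1, ‖F n t‖) =
      (|A n| / (ascPochhammer ℝ n).eval (3 / 2 + H) * (1 / x) ^ n) / (H + 1 / 2) := by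
    intro n
    have : (∫ t in Set.Ioo (0:ℝ) 1, ‖F n t‖) = ∫ t in Set.Ioo (0:ℝ) 1,
        (|A n| / (Nat.factorial n : ℝ) * (1 / x) ^ n) * (t ^ n * (1 - t) ^ (H + 1 / 2 - 1)) := by
      apply setIntegral_congr_fun measurableSet_Ioo
      intro t ht
      have h1 : 0 ≤ t ^ n * (1 - t) ^ (H + 1 / 2 - 1) :=
        mul_nonneg (pow_nonneg ht.1.le _) (Real.rpow_nonneg (by linarith [ht.2]) _)
      simp only [hF]
      rw [norm_mul, Real.norm_of_nonneg h1, norm_mul, norm_div, Real.norm_eq_abs,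
        Real.norm_of_nonneg (by positivity : (0:ℝ) ≤ (Nat.factorial n : ℝ)),
        Real.norm_of_nonneg (by positivity : (0:ℝ) ≤ (1 / x) ^ n)]
    rw [this, integral_const_mul, hmom]
    have h1 := hP n
    have h2 : (Nat.factorial n : ℝ) ≠ 0 := by positivity
    field_simp
  have hval : ∀ n, (∫ t in Set.Ioo (0:ℝ) 1, F n t) =
      (A n / (ascPochhammer ℝ n).eval (3 / 2 + H) * (1 / x) ^ n) / (H + 1 / 2) := by
    intro n
    simp only [hF]
    rw [integral_const_mul, hmom]
    have h1 := hP n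
    have h2 : (Nat.factorial n : ℝ) ≠ 0 := by positivity
    field_simp
  have hsum := hasSum_integral_of_summable_integral_norm hint (by
    simp only [hnorm]; exact hS2.div_const _)
  simp only [hval] at hsum
  have h1 := hsum.tsum_eq
  rw [tsum_div_const] at h1
  rw [intervalIntegral.integral_of_le zero_le_one, integral_Ioc_eq_integral_Ioo]
  have h2 : (∫ t in Set.Ioo (0:ℝ) 1, 2 * H * (x - t) ^ (H - 1 / 2) * (1 - t) ^ (H - 1 / 2)) =
      ∫ t in Set.Ioo (0:ℝ) 1, (2 * H * (1 / x) ^ ((1 : ℝ) / 2 - H)) * ∑' n, F n t := by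
    apply setIntegral_congr_fun measurableSet_Ioo
    intro t ht
    have hy : t / x < 1 := by rw [div_lt_one hx0]; linarith [ht.2]
    have hb := aux_binom (1 / 2 - H) (t / x) (div_nonneg ht.1.le hx0.le) hy
    have hb2 := (hb.mul_right ((1 - t) ^ (H + 1 / 2 - 1))).tsum_eq
    have hb3 : ∑' n, F n t = (1 - t / x) ^ (-(1 / 2 - H)) * (1 - t) ^ (H + 1 / 2 - 1) := by
      rw [← hb2]
      congr 1
      ext n
      simp only [hF, hA]
      rw [div_pow, div_pow, one_pow]
      ring
    have e1 : (x - t) = x * (1 - t / x) := by field_simp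
    have e2 : H + 1 / 2 - 1 = H - 1 / 2 := by ring
    have e3 : -(1 / 2 - H) = H - 1 / 2 := by ring
    have e4 : (1 / x) ^ ((1 : ℝ) / 2 - H) = x ^ (H - 1 / 2) := by
      rw [one_div, Real.inv_rpow hx0.le, ← Real.rpow_neg hx0.le, e3]
    simp only [hb3]
    rw [e2, e3, e4, e1, Real.mul_rpow hx0.le (by linarith)]
    ring
  rw [h2, integral_const_mul, ← h1, add_comm H (1 / 2)]
  ring
end

section
/- For every λ > 0, H ∈ (0,1), and s ≥ 0, ∫_{−∞}^{∞} cos(s·x) · |x|^{1−2H} / (λ² + x²) dx = (π / sin(πH)) · [ λ^{−2H}·cosh(λs) − (s^{2H}/Γ(2H+1)) · Σ_{n=0}^∞ ( (1)_n / ((H+1/2)_n · (H+1)_n) ) · (λ²s²/4)^n / n! ], where the series on the right converges. -/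
open MeasureTheory

lemma tonelli15 (f : ℝ → ℝ → ℝ) (a b : ℝ → ℝ) (hm : Measurable (Function.uncurry f))
    (hp : ∀ x > 0, ∀ y > 0, 0 ≤ f x y)
    (ha : ∀ x > 0, ∫ y in Set.Ioi (0:ℝ), f x y = a x)
    (hbi : ∀ y > 0, IntegrableOn (fun x => f x y) (Set.Ioi 0))
    (hb : ∀ y > 0, ∫ x in Set.Ioi (0:ℝ), f x y = b y)
    (hbint : IntegrableOn b (Set.Ioi 0)) :
    IntegrableOn a (Set.Ioi 0) ∧ ∫ x in Set.Ioi (0:ℝ), a x = ∫ y in Set.Ioi (0:ℝ), b y := by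
  have hint : Integrable (Function.uncurry f)
      ((volume.restrict (Set.Ioi (0:ℝ))).prod (volume.restrict (Set.Ioi (0:ℝ)))) := by
    rw [integrable_prod_iff' hm.aestronglyMeasurable]
    constructor
    · filter_upwards [ae_restrict_mem measurableSet_Ioi] with y hy
      exact hbi y hy
    · refine hbint.congr ?_
      filter_upwards [ae_restrict_mem measurableSet_Ioi] with y hy
      rw [← hb y hy]
      refine setIntegral_congr_fun measurableSet_Ioi fun x hx => ?_
      simp only [Function.uncurry]
      rw [Real.norm_of_nonneg (hp x hx y hy)]
  constructor
  · refine hint.integral_prod_left.congr ?_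
    filter_upwards [ae_restrict_mem measurableSet_Ioi] with x hx
    exact ha x hx
  · rw [← setIntegral_congr_fun measurableSet_Ioi fun x hx => ha x hx,
      ← setIntegral_congr_fun measurableSet_Ioi fun y hy => hb y hy]
    exact integral_integral_swap hint

lemma base15 (a lam : ℝ) (h0 : 0 < a) (h2 : a < 2) (hl : 0 < lam) :
    IntegrableOn (fun y : ℝ => y ^ (a - 1) / (lam ^ 2 + y ^ 2)) (Set.Ioi 0) ∧
    ∫ y in Set.Ioi (0:ℝ), y ^ (a - 1) / (lam ^ 2 + y ^ 2) =
      lam ^ (a - 2) * (Real.pi / (2 * Real.sin (Real.pi * (a / 2)))) := by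
  have hG : ∀ u > (0:ℝ), u ^ (-(a/2)) * Real.exp (-(lam^2 * u)) =
    u ^ ((1 - a/2) - 1) * Real.exp (-(lam^2 * u)) := by
    intro u hu; congr 2; ring
  have key := tonelli15 (fun y u => y ^ (a - 1) * Real.exp (-u * (lam ^ 2 + y ^ 2)))
    (fun y => y ^ (a - 1) / (lam ^ 2 + y ^ 2))
    (fun u => Real.Gamma (a/2) / 2 * (u ^ (-(a/2)) * Real.exp (-(lam^2 * u))))
    (by unfold Function.uncurry; fun_prop)
    (fun x hx y hy => by have : (0:ℝ) < x := hx; positivity)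
    (fun x hx => by
      have : (0:ℝ) < lam ^ 2 + x ^ 2 := by positivity
      rw [integral_const_mul]
      have h := integral_exp_mul_Ioi (a := -(lam ^ 2 + x ^ 2)) (by linarith) 0
      have e : ∀ u : ℝ, -u * (lam ^ 2 + x ^ 2) = -(lam ^ 2 + x ^ 2) * u := fun u => by ring
      simp only [e]
      rw [h, neg_div_neg_eq]; simp [div_eq_mul_inv])
    (fun y hy => by
      have := (integrableOn_rpow_mul_exp_neg_mul_sq (b := y) hy (s := a - 1) (by linarith)).const_mul (Real.exp (-y * lam^2))
      refine this.congr ?_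
      filter_upwards with x
      rw [mul_add, Real.exp_add]; ring)
    (fun y hy => by
      have h := integral_rpow_mul_exp_neg_mul_rpow (p := 2) (q := a - 1) (b := y) (by norm_num) (by linarith) hy
      have e : ∀ x : ℝ, x ^ (a - 1) * Real.exp (-y * (lam ^ 2 + x ^ 2)) =
          Real.exp (-(lam^2 * y)) * (x ^ (a-1) * Real.exp (-y * x ^ (2:ℝ))) := fun x => by
        rw [mul_add, Real.exp_add, Real.rpow_two, show -(lam^2 * y) = -y * lam ^ 2 by ring]; ring
      simp only [e]
      rw [integral_const_mul, h]
      rw [show (a - 1 + 1) = a by ring, show -a/2 = -(a/2) by ring]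
      ring)
    (by
      refine Integrable.const_mul ?_ _
      have := integrableOn_rpow_mul_exp_neg_mul_rpow (p := 1) (s := -(a/2)) (b := lam^2) (by linarith) one_pos (by positivity)
      simpa [IntegrableOn] using this)
  refine ⟨key.1, key.2.trans ?_⟩
  rw [integral_const_mul, setIntegral_congr_fun measurableSet_Ioi hG,
    Real.integral_rpow_mul_exp_neg_mul_Ioi (by linarith) (by positivity)]
  have := Real.Gamma_mul_Gamma_one_sub (a/2)
  have e : (1 / lam ^ 2) ^ (1 - a / 2) = lam ^ (a - 2) := by
    rw [one_div, Real.inv_rpow (by positivity), ← Real.rpow_neg (by positivity), ← Real.rpow_natCast,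
      ← Real.rpow_mul hl.le]
    congr 1; push_cast; ring
  rw [e]
  calc _ = lam ^ (a-2) * (Real.Gamma (a/2) * Real.Gamma (1 - a/2)) / 2 := by ring
    _ = _ := by rw [this]; ring

lemma lap15 (s y : ℝ) (hy : 0 < y) :
    IntegrableOn (fun x : ℝ => (1 - Real.cos (s * x)) * Real.exp (-y * x)) (Set.Ioi 0) ∧
    ∫ x in Set.Ioi (0:ℝ), (1 - Real.cos (s * x)) * Real.exp (-y * x) =
      s ^ 2 / (y * (s ^ 2 + y ^ 2)) := by
  have hI : IntegrableOn (fun x : ℝ => (1 - Real.cos (s * x)) * Real.exp (-y * x)) (Set.Ioi 0) := by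
    refine ((integrableOn_exp_mul_Ioi (a := -y) (by linarith) 0).const_mul 2).mono'
      (by fun_prop) ?_
    filter_upwards with x
    rw [norm_mul, Real.norm_of_nonneg (Real.exp_pos _).le]
    gcongr
    rw [Real.norm_eq_abs, abs_le]
    constructor <;> linarith [Real.neg_one_le_cos (s * x), Real.cos_le_one (s*x)]
  refine ⟨hI, ?_⟩
  have hne : s ^ 2 + y ^ 2 ≠ 0 := by positivity
  have key := integral_Ioi_of_hasDerivAt_of_tendsto' (a := 0) (m := 0)
    (f := fun x => (-1 / y + (y * Real.cos (s*x) - s * Real.sin (s*x)) / (s^2+y^2)) * Real.exp (-y * x))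
    (f' := fun x : ℝ => (1 - Real.cos (s * x)) * Real.exp (-y * x)) ?_ hI ?_
  · rw [key]; simp; field_simp; ring
  · intro x _
    have h1 : HasDerivAt (fun x : ℝ => s * x) s x := by simpa using (hasDerivAt_id x).const_mul s
    have h2 : HasDerivAt (fun x : ℝ => -y * x) (-y) x := by simpa using (hasDerivAt_id x).const_mul (-y)
    have := ((((h1.cos.const_mul y).sub (h1.sin.const_mul s)).div_const (s^2+y^2)).const_add (-1/y)).mul h2.exp
    refine this.congr_deriv ?_
    field_simp
    simp only [Pi.sub_apply]
    ring
  · have hexp : Filter.Tendsto (fun x : ℝ => Real.exp (-y * x)) Filter.atTop (nhds 0) := by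
      refine Real.tendsto_exp_atBot.comp ?_
      exact Filter.tendsto_id.const_mul_atTop_of_neg (by linarith)
    refine Filter.Tendsto.zero_mul_isBoundedUnder_le (f := fun x : ℝ => Real.exp (-y * x)) hexp
      (g := fun x => (-1 / y + (y * Real.cos (s*x) - s * Real.sin (s*x)) / (s^2+y^2))) ?_ |>.congr ?_
    · refine Filter.isBoundedUnder_of ⟨1/y + (y + |s|)/(s^2+y^2), fun x => ?_⟩
      simp only [Function.comp]
      refine (norm_add_le _ _).trans ?_
      have : ‖(-1/y)‖ = 1/y := by rw [norm_div, norm_neg, norm_one, Real.norm_of_nonneg hy.le]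
      rw [this, norm_div, Real.norm_of_nonneg (by positivity : 0 ≤ s^2+y^2)]
      gcongr
      refine (norm_sub_le _ _).trans ?_
      rw [norm_mul, norm_mul, Real.norm_of_nonneg hy.le]
      have := Real.abs_cos_le_one (s*x)
      have := Real.abs_sin_le_one (s*x)
      simp only [Real.norm_eq_abs]
      have := abs_nonneg s
      nlinarith
    · intro x; ring

lemma M15 (H s : ℝ) (h0 : 0 < H) (h1 : H < 1) (hs : 0 < s) :
    IntegrableOn (fun x : ℝ => (1 - Real.cos (s * x)) * x ^ (-(1 + 2 * H))) (Set.Ioi 0) ∧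
    ∫ x in Set.Ioi (0:ℝ), (1 - Real.cos (s * x)) * x ^ (-(1 + 2 * H)) =
      s ^ (2 * H) * (Real.pi / (2 * Real.sin (Real.pi * H) * Real.Gamma (2 * H + 1))) := by
  have hb := base15 (2 * H) s (by linarith) (by linarith) hs
  have hΓ : 0 < Real.Gamma (2 * H + 1) := Real.Gamma_pos_of_pos (by linarith)
  have key := tonelli15 (fun x y => (1 - Real.cos (s * x)) * (y ^ (2 * H) * Real.exp (-y * x)))
    (fun x => Real.Gamma (2 * H + 1) * ((1 - Real.cos (s * x)) * x ^ (-(1 + 2 * H))))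
    (fun y => s ^ 2 * (y ^ (2 * H - 1) / (s ^ 2 + y ^ 2)))
    (by unfold Function.uncurry; fun_prop)
    (fun x hx y hy => by
      have : (0:ℝ) < y := hy
      have := Real.cos_le_one (s * x)
      have : 0 ≤ 1 - Real.cos (s * x) := by linarith
      positivity)
    (fun x hx => by
      rw [integral_const_mul]
      have h := Real.integral_rpow_mul_exp_neg_mul_Ioi (a := 2 * H + 1) (r := x) (by linarith) hx
      have e : ∀ y : ℝ, y ^ (2 * H) * Real.exp (-y * x) = y ^ (2 * H + 1 - 1) * Real.exp (-(x * y)) := by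
        intro y; congr 2 <;> ring
      simp only [e]
      rw [h, one_div, Real.inv_rpow (le_of_lt hx), ← Real.rpow_neg (le_of_lt hx), add_comm (2*H) 1]
      ring)
    (fun y hy => by
      refine ((lap15 s y hy).1.const_mul (y ^ (2*H))).congr ?_
      filter_upwards with x
      ring)
    (fun y hy => by
      have e : ∀ x : ℝ, (1 - Real.cos (s * x)) * (y ^ (2 * H) * Real.exp (-y * x)) =
        y ^ (2*H) * ((1 - Real.cos (s * x)) * Real.exp (-y * x)) := fun x => by ring
      simp only [e]
      have hy' : (0:ℝ) < y := hy
      rw [integral_const_mul, (lap15 s y hy).2, Real.rpow_sub_one hy'.ne']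
      have hne : s ^ 2 + y ^ 2 ≠ 0 := by positivity
      field_simp)
    (hb.1.const_mul _)
  constructor
  · refine (key.1.const_mul (Real.Gamma (2 * H + 1))⁻¹).congr ?_
    filter_upwards with x
    field_simp
  · have h2 := key.2
    rw [integral_const_mul, integral_const_mul, hb.2] at h2
    have e : s ^ 2 * s ^ (2 * H - 2) = s ^ (2 * H) := by
      rw [← Real.rpow_two, ← Real.rpow_add hs]; congr 1; ring
    rw [show 2 * H / 2 = H by ring, ← mul_assoc, e] at h2
    have : ∀ X : ℝ, Real.Gamma (2 * H + 1) * X = s ^ (2 * H) * (Real.pi / (2 * Real.sin (Real.pi * H))) → X = s ^ (2 * H) * (Real.pi / (2 * Real.sin (Real.pi * H) * Real.Gamma (2 * H + 1))) := by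
      intro X hX
      rw [← div_div, ← mul_div_assoc, ← hX]; field_simp
    exact this _ h2

lemma cosrep15 (s x : ℝ) (hx : x ≠ 0) :
    ∫ u in (0:ℝ)..s, (s - u) * Real.cos (u * x) = (1 - Real.cos (s * x)) / x ^ 2 := by
  have h := intervalIntegral.integral_eq_sub_of_hasDerivAt (a := 0) (b := s)
    (f := fun u => (s - u) * Real.sin (u * x) / x - Real.cos (u * x) / x ^ 2)
    (f' := fun u => (s - u) * Real.cos (u * x)) ?_ (by apply Continuous.intervalIntegrable; fun_prop)
  · rw [h]; simp; ring
  · intro u _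
    have h1 : HasDerivAt (fun u : ℝ => u * x) x u := by simpa using (hasDerivAt_id u).mul_const x
    have h2 : HasDerivAt (fun u : ℝ => s - u) (-1) u := by simpa using (hasDerivAt_id u).const_sub s
    have := ((h2.mul h1.sin).div_const x).sub (h1.cos.div_const (x^2))
    refine this.congr_deriv ?_
    field_simp
    ring

lemma volterra15 (lam H : ℝ) (hl : 0 < lam) (h0 : 0 < H) (h1 : H < 1) (J : ℝ → ℝ)
    (hJ : ∀ s, J s = ∫ x in Set.Ioi (0:ℝ), Real.cos (s * x) * (x ^ (1 - 2 * H) / (lam ^ 2 + x ^ 2))) :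
    Continuous J ∧
    J 0 = lam ^ (-(2 * H)) * (Real.pi / (2 * Real.sin (Real.pi * H))) ∧
    (∀ s, |J s| ≤ J 0) ∧
    ∀ s, 0 ≤ s → J s = J 0 -
      (Real.pi / (2 * Real.sin (Real.pi * H) * Real.Gamma (2 * H + 1))) * s ^ (2 * H) +
      lam ^ 2 * ∫ u in (0:ℝ)..s, (s - u) * J u := by
  obtain ⟨hwi, hw⟩ := base15 (2 - 2 * H) lam (by linarith) (by linarith) hl
  rw [show 2 - 2 * H - 1 = 1 - 2 * H by ring] at hwi hw
  have hJ' : J = fun s => ∫ x in Set.Ioi (0:ℝ), Real.cos (s * x) * (x ^ (1 - 2 * H) / (lam ^ 2 + x ^ 2)) := funext hJ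
  have hbd : ∀ s : ℝ, ∀ᵐ x ∂(volume.restrict (Set.Ioi (0:ℝ))),
      ‖Real.cos (s * x) * (x ^ (1 - 2 * H) / (lam ^ 2 + x ^ 2))‖ ≤ x ^ (1 - 2 * H) / (lam ^ 2 + x ^ 2) := by
    intro s
    filter_upwards [ae_restrict_mem measurableSet_Ioi] with x hx
    have hx' : (0:ℝ) < x := hx
    have hp : 0 ≤ x ^ (1 - 2 * H) / (lam ^ 2 + x ^ 2) := by positivity
    rw [norm_mul, Real.norm_of_nonneg hp]
    exact mul_le_of_le_one_left hp (Real.abs_cos_le_one _)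
  have hmeas : ∀ s : ℝ, AEStronglyMeasurable (fun x : ℝ => Real.cos (s * x) * (x ^ (1 - 2 * H) / (lam ^ 2 + x ^ 2))) (volume.restrict (Set.Ioi (0:ℝ))) := by
    intro s
    apply Measurable.aestronglyMeasurable
    fun_prop
  have hint : ∀ s : ℝ, IntegrableOn (fun x : ℝ => Real.cos (s * x) * (x ^ (1 - 2 * H) / (lam ^ 2 + x ^ 2))) (Set.Ioi 0) :=
    fun s => Integrable.mono' hwi (hmeas s) (hbd s)
  have hJ0 : J 0 = ∫ x in Set.Ioi (0:ℝ), x ^ (1 - 2 * H) / (lam ^ 2 + x ^ 2) := by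
    rw [hJ]; simp
  have hcont : Continuous J := by
    rw [hJ']
    refine continuous_of_dominated hmeas hbd hwi ?_
    filter_upwards with x
    fun_prop
  refine ⟨hcont, ?_, ?_, ?_⟩
  · rw [hJ0, hw, show 2 - 2 * H - 2 = -(2 * H) by ring,
      show Real.pi * ((2 - 2 * H) / 2) = Real.pi - Real.pi * H by ring, Real.sin_pi_sub]
  · intro s
    rw [hJ0, hJ s]
    exact norm_integral_le_of_norm_le hwi (hbd s)
  · intro s hs
    rcases hs.eq_or_lt with rfl | hs
    · rw [Real.zero_rpow (by linarith)]; simp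
    obtain ⟨hMi, hM⟩ := M15 H s h0 h1 hs
    have hswap : ∫ u in (0:ℝ)..s, (s - u) * J u =
        ∫ x in Set.Ioi (0:ℝ), (1 - Real.cos (s * x)) / x ^ 2 * (x ^ (1 - 2 * H) / (lam ^ 2 + x ^ 2)) := by
      have := intervalIntegral_integral_swap (a := 0) (b := s) (μ := volume.restrict (Set.Ioi (0:ℝ)))
        (f := fun u x => ((s - u) * Real.cos (u * x)) * (x ^ (1 - 2 * H) / (lam ^ 2 + x ^ 2))) ?_
      · simp only [mul_assoc, integral_const_mul] at this
        simp only [← hJ] at this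
        rw [this]
        refine setIntegral_congr_fun measurableSet_Ioi fun x hx => ?_
        simp only [← mul_assoc]
        rw [intervalIntegral.integral_mul_const, cosrep15 s x (ne_of_gt hx)]
      · have hsi : Integrable (fun u : ℝ => s - u) (volume.restrict (Set.uIoc 0 s)) := by
          rw [← IntegrableOn, ← intervalIntegrable_iff]
          apply Continuous.intervalIntegrable; fun_prop
        refine (hsi.mul_prod hwi).mono (by
          apply Measurable.aestronglyMeasurable
          unfold Function.uncurry
          fun_prop) ?_
        filter_upwards with z
        simp only [Function.uncurry]
        rw [norm_mul, norm_mul, norm_mul]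
        gcongr
        exact mul_le_of_le_one_right (norm_nonneg _) (Real.abs_cos_le_one _)
    have hpt : ∀ x ∈ Set.Ioi (0:ℝ), Real.cos (s * x) * (x ^ (1 - 2 * H) / (lam ^ 2 + x ^ 2)) =
        x ^ (1 - 2 * H) / (lam ^ 2 + x ^ 2) - (1 - Real.cos (s * x)) * x ^ (-(1 + 2 * H)) +
        lam ^ 2 * ((1 - Real.cos (s * x)) / x ^ 2 * (x ^ (1 - 2 * H) / (lam ^ 2 + x ^ 2))) := by
      intro x hx
      have hx' : (0:ℝ) < x := hx
      have e : x ^ (-(1 + 2 * H)) = x ^ (1 - 2 * H) / x ^ 2 := by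
        rw [← Real.rpow_two, ← Real.rpow_sub hx']; congr 1; ring
      rw [e]
      have : lam ^ 2 + x ^ 2 ≠ 0 := by positivity
      field_simp
      ring
    have hRi : IntegrableOn (fun x : ℝ => lam ^ 2 * ((1 - Real.cos (s * x)) / x ^ 2 * (x ^ (1 - 2 * H) / (lam ^ 2 + x ^ 2)))) (Set.Ioi 0) := by
      refine (((hint s).sub hwi).add hMi).congr ?_
      filter_upwards [ae_restrict_mem measurableSet_Ioi] with x hx
      simp only [Pi.add_apply, Pi.sub_apply]
      rw [hpt x hx]; ring
    rw [hswap, ← integral_const_mul, hJ0, mul_comm _ (s ^ (2 * H)), ← hM, hJ s,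
      setIntegral_congr_fun measurableSet_Ioi hpt, ← integral_sub hwi hMi]
    exact integral_add (hwi.sub hMi) hRi

lemma powint15 (r s : ℝ) (hr : 0 ≤ r) (hs : 0 ≤ s) :
    IntervalIntegrable (fun u : ℝ => (s - u) * u ^ r) volume 0 s ∧
    ∫ u in (0:ℝ)..s, (s - u) * u ^ r = s ^ (r + 2) / ((r + 1) * (r + 2)) := by
  have h1 : IntervalIntegrable (fun u : ℝ => s * u ^ r) volume 0 s :=
    (intervalIntegral.intervalIntegrable_rpow' (by linarith)).const_mul s
  have h2 : IntervalIntegrable (fun u : ℝ => u ^ (r+1)) volume 0 s :=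
    intervalIntegral.intervalIntegrable_rpow' (by linarith)
  have e : ∀ u ∈ Set.uIcc 0 s, (s - u) * u ^ r = s * u ^ r - u ^ (r + 1) := by
    intro u hu
    rw [Set.uIcc_of_le hs] at hu
    rw [Real.rpow_add_one' hu.1 (by linarith)]; ring
  constructor
  · refine IntervalIntegrable.congr (f := fun u : ℝ => s * u ^ r - u ^ (r + 1)) ?_ (h1.sub h2)
    intro u hu
    exact (e u (Set.uIoc_subset_uIcc hu)).symm
  · rw [intervalIntegral.integral_congr e, intervalIntegral.integral_sub h1 h2,
      intervalIntegral.integral_const_mul, integral_rpow (Or.inl (by linarith)),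
      integral_rpow (Or.inl (by linarith)), Real.zero_rpow (by linarith), Real.zero_rpow (by linarith),
      show r + 2 = (r + 1) + 1 by ring, Real.rpow_add_one' hs (by linarith : r + 1 + 1 ≠ 0)]
    field_simp
    ring

/-- coefficients of the iterated kernel -/
noncomputable def T15 (A B lam H : ℝ) (k : ℕ) (s : ℝ) : ℝ :=
  A * (lam * s) ^ (2 * k) / (Nat.factorial (2 * k) : ℝ) -
    B * lam ^ (2 * k) * s ^ (2 * H + 2 * k) /
      (4 ^ k * ((ascPochhammer ℝ k).eval (H + 1 / 2) * (ascPochhammer ℝ k).eval (H + 1)))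

lemma T15_succ (A B lam H : ℝ) (h0 : 0 < H) (k : ℕ) (s : ℝ) (hs : 0 ≤ s) :
    IntervalIntegrable (fun u => (s - u) * T15 A B lam H k u) volume 0 s ∧
    lam ^ 2 * ∫ u in (0:ℝ)..s, (s - u) * T15 A B lam H k u = T15 A B lam H (k + 1) s := by
  obtain ⟨i1, v1⟩ := powint15 (2 * k : ℕ) s (by positivity) hs
  obtain ⟨i2, v2⟩ := powint15 (2 * H + 2 * k) s (by positivity) hs
  have e : ∀ u : ℝ, (s - u) * T15 A B lam H k u =
      (A * lam ^ (2 * k) / (Nat.factorial (2 * k) : ℝ)) * ((s - u) * u ^ ((2 * k : ℕ) : ℝ)) -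
      (B * lam ^ (2 * k) / (4 ^ k * ((ascPochhammer ℝ k).eval (H + 1 / 2) * (ascPochhammer ℝ k).eval (H + 1)))) *
        ((s - u) * u ^ (2 * H + 2 * k)) := by
    intro u
    rw [Real.rpow_natCast]; unfold T15; ring
  simp only [e]
  have j1 := i1.const_mul (A * lam ^ (2 * k) / (Nat.factorial (2 * k) : ℝ))
  have j2 := i2.const_mul (B * lam ^ (2 * k) / (4 ^ k * ((ascPochhammer ℝ k).eval (H + 1 / 2) * (ascPochhammer ℝ k).eval (H + 1))))
  refine ⟨j1.sub j2, ?_⟩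
  rw [intervalIntegral.integral_sub j1 j2, intervalIntegral.integral_const_mul,
    intervalIntegral.integral_const_mul, v1, v2]
  unfold T15
  have p1 := ascPochhammer_pos k (H + 1/2) (by linarith)
  have p2 := ascPochhammer_pos k (H + 1) (by linarith)
  rw [ascPochhammer_succ_eval, ascPochhammer_succ_eval, show 2 * (k + 1) = 2 * k + 1 + 1 by ring,
    Nat.factorial_succ, Nat.factorial_succ,
    show ((2 * k : ℕ) : ℝ) + 2 = ((2 * k + 1 + 1 : ℕ) : ℝ) by push_cast; ring, Real.rpow_natCast,
    show 2 * H + 2 * ((k + 1 : ℕ) : ℝ) = 2 * H + 2 * k + 2 by push_cast; ring]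
  have q1 : H + 1 / 2 + (k:ℝ) ≠ 0 := by positivity
  have q2 : H + 1 + (k:ℝ) ≠ 0 := by positivity
  have q3 : 2 * H + 2 * (k:ℝ) + 1 = 2 * (H + 1/2 + k) := by ring
  have q4 : 2 * H + 2 * (k:ℝ) + 2 = 2 * (H + 1 + k) := by ring
  generalize s ^ (2 * H + 2 * (k:ℝ) + 2) = S
  rw [q3, q4]
  generalize H + 1 / 2 + (k:ℝ) = X at *
  generalize H + 1 + (k:ℝ) = Y at *
  have p1' := p1.ne'
  have p2' := p2.ne'
  generalize Polynomial.eval (H + 1 / 2) (ascPochhammer ℝ k) = P at *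
  generalize Polynomial.eval (H + 1) (ascPochhammer ℝ k) = Q at *
  push_cast
  have f0 : ((2 * k).factorial : ℝ) ≠ 0 := by positivity
  have f1 : (2 * (k:ℝ) + 1) ≠ 0 := by positivity
  have f2 : (2 * (k:ℝ) + 1 + 1) ≠ 0 := by positivity
  rw [mul_sub]
  congr 1
  · field_simp
    ring
  · field_simp
    ring

lemma iter15 (A B lam H : ℝ) (h0 : 0 < H) (J : ℝ → ℝ) (hc : Continuous J)
    (hA : ∀ s, |J s| ≤ A)
    (hV : ∀ s, 0 ≤ s → J s = A - B * s ^ (2 * H) + lam ^ 2 * ∫ u in (0:ℝ)..s, (s - u) * J u)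
    (N : ℕ) : ∀ s, 0 ≤ s →
    |J s - ∑ k ∈ Finset.range N, T15 A B lam H k s| ≤ A * (lam * s) ^ (2 * N) / (Nat.factorial (2 * N) : ℝ) := by
  induction N with
  | zero => intro s _; simpa using hA s
  | succ N ih =>
    intro s hs
    have iJ : IntervalIntegrable (fun u => (s - u) * J u) volume 0 s := by
      apply Continuous.intervalIntegrable; fun_prop
    have iT : ∀ k ∈ Finset.range N, IntervalIntegrable (fun u => (s - u) * T15 A B lam H k u) volume 0 s :=
      fun k _ => (T15_succ A B lam H h0 k s hs).1
    have hsum : J s - ∑ k ∈ Finset.range (N + 1), T15 A B lam H k s =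
        lam ^ 2 * ∫ u in (0:ℝ)..s, (s - u) * (J u - ∑ k ∈ Finset.range N, T15 A B lam H k u) := by
      have e : ∀ u, (s - u) * (J u - ∑ k ∈ Finset.range N, T15 A B lam H k u) =
          (s - u) * J u - ∑ k ∈ Finset.range N, (s - u) * T15 A B lam H k u := by
        intro u; rw [mul_sub, Finset.mul_sum]
      simp only [e]
      have iS : IntervalIntegrable (fun u => ∑ k ∈ Finset.range N, (s - u) * T15 A B lam H k u) volume 0 s := by
        have e2 : (fun u => ∑ k ∈ Finset.range N, (s - u) * T15 A B lam H k u) =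
            ∑ k ∈ Finset.range N, fun u => (s - u) * T15 A B lam H k u := by
          ext u; simp
        rw [e2]
        exact IntervalIntegrable.sum _ iT
      rw [intervalIntegral.integral_sub iJ iS, intervalIntegral.integral_finsetSum iT, mul_sub,
        Finset.mul_sum, Finset.sum_range_succ', Finset.sum_congr rfl
          (fun k _ => (T15_succ A B lam H h0 k s hs).2), hV s hs]
      simp [T15]
      ring
    rw [hsum]
    obtain ⟨i1, v1⟩ := powint15 (2 * N : ℕ) s (by positivity) hs
    have hb : |∫ u in (0:ℝ)..s, (s - u) * (J u - ∑ k ∈ Finset.range N, T15 A B lam H k u)| ≤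
        ∫ u in (0:ℝ)..s, (A * lam ^ (2 * N) / (Nat.factorial (2 * N) : ℝ)) * ((s - u) * u ^ ((2 * N : ℕ) : ℝ)) := by
      rw [← Real.norm_eq_abs]
      refine intervalIntegral.norm_integral_le_of_norm_le hs ?_ (i1.const_mul _)
      filter_upwards with u hu
      rw [norm_mul, Real.norm_of_nonneg (by linarith [hu.2] : 0 ≤ s - u), Real.norm_eq_abs, Real.rpow_natCast]
      have := mul_le_mul_of_nonneg_left (ih u hu.1.le) (by linarith [hu.2] : 0 ≤ s - u)
      refine this.trans (le_of_eq ?_)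
      ring
    rw [intervalIntegral.integral_const_mul, v1] at hb
    rw [abs_mul, abs_of_nonneg (sq_nonneg lam)]
    refine (mul_le_mul_of_nonneg_left hb (sq_nonneg lam)).trans (le_of_eq ?_)
    rw [show 2 * (N + 1) = 2 * N + 1 + 1 by ring,
      Nat.factorial_succ, Nat.factorial_succ,
      show ((2 * N : ℕ) : ℝ) + 2 = ((2 * N + 1 + 1 : ℕ) : ℝ) by push_cast; ring, Real.rpow_natCast]
    push_cast
    have f0 : ((2 * N).factorial : ℝ) ≠ 0 := by positivity
    have f1 : (2 * (N:ℝ) + 1) ≠ 0 := by positivity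
    have f2 : (2 * (N:ℝ) + 1 + 1) ≠ 0 := by positivity
    field_simp
    ring

lemma summable15 (H z : ℝ) (h0 : 0 < H) (hz : 0 ≤ z) : Summable (fun n : ℕ =>
      (ascPochhammer ℝ n).eval 1 /
          ((ascPochhammer ℝ n).eval (H + 1 / 2) * (ascPochhammer ℝ n).eval (H + 1)) *
        z ^ n / (Nat.factorial n : ℝ)) := by
  have hpos : ∀ n : ℕ, 0 < (ascPochhammer ℝ n).eval (H + 1/2) := fun n => ascPochhammer_pos n _ (by linarith)
  have hfac : ∀ n : ℕ, (Nat.factorial n : ℝ) ≤ (ascPochhammer ℝ n).eval (H + 1) := by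
    intro n
    induction n with
    | zero => simp
    | succ n ih =>
      rw [ascPochhammer_succ_eval, Nat.factorial_succ]
      push_cast
      rw [mul_comm]
      refine mul_le_mul ih (by linarith) (by positivity) (le_trans (by positivity) ih)
  have hfac2 : ∀ n : ℕ, (Nat.factorial n : ℝ) ≤ (ascPochhammer ℝ n).eval (H + 1/2) * (1 / H + 2) ^ n := by
    intro n
    induction n with
    | zero => simp
    | succ n ih =>
      rw [ascPochhammer_succ_eval, Nat.factorial_succ]
      push_cast
      rw [pow_succ]
      calc ((n:ℝ) + 1) * (n.factorial : ℝ) ≤ ((H + 1/2 + n) * (1 / H + 2)) * ((ascPochhammer ℝ n).eval (H + 1/2) * (1 / H + 2) ^ n) := by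
            gcongr
            have : (H + 1/2 + n) * (1 / H + 2) = 2 + 2 * H + 2 * n + (1/2 + n) / H := by
              field_simp; ring
            rw [this]
            have : 0 ≤ (1/2 + (n:ℝ)) / H := by positivity
            have : 0 ≤ (n:ℝ) := by positivity
            linarith
        _ = _ := by ring
  refine Summable.of_nonneg_of_le (f := fun n : ℕ => ((1 / H + 2) * z) ^ n / (Nat.factorial n : ℝ)) ?_ ?_
    (Real.summable_pow_div_factorial _)
  · intro n
    have := hpos n
    have : 0 < (ascPochhammer ℝ n).eval (H + 1) := ascPochhammer_pos n _ (by linarith)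
    have : 0 < (ascPochhammer ℝ n).eval (1:ℝ) := ascPochhammer_pos n _ (by linarith)
    positivity
  · intro n
    have a1 := hpos n
    have a2 : 0 < (ascPochhammer ℝ n).eval (H + 1) := ascPochhammer_pos n _ (by linarith)
    rw [ascPochhammer_eval_one, mul_pow]
    gcongr
    rw [div_le_iff₀ (by positivity)]
    calc (n.factorial : ℝ) ≤ (ascPochhammer ℝ n).eval (H + 1/2) * (1 / H + 2) ^ n * 1 := by simpa using hfac2 n
      _ ≤ (ascPochhammer ℝ n).eval (H + 1/2) * (1 / H + 2) ^ n * (ascPochhammer ℝ n).eval (H + 1) := by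
        gcongr
        refine le_trans ?_ (hfac n)
        exact_mod_cast Nat.succ_le_of_lt (Nat.factorial_pos n)
      _ = _ := by ring

theorem stmt_15 (lam H s : ℝ) (hlam : 0 < lam) (hH : H ∈ Set.Ioo (0 : ℝ) 1)
    (hs : 0 ≤ s) :
    Summable (fun n : ℕ =>
      (ascPochhammer ℝ n).eval 1 /
          ((ascPochhammer ℝ n).eval (H + 1 / 2) * (ascPochhammer ℝ n).eval (H + 1)) *
        (lam ^ 2 * s ^ 2 / 4) ^ n / (Nat.factorial n : ℝ)) ∧
    (∫ x : ℝ, Real.cos (s * x) * |x| ^ (1 - 2 * H) / (lam ^ 2 + x ^ 2)) =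
      Real.pi / Real.sin (Real.pi * H) *
        (lam ^ (-(2 * H)) * Real.cosh (lam * s) -
          s ^ (2 * H) / Real.Gamma (2 * H + 1) *
            ∑' n : ℕ,
              (ascPochhammer ℝ n).eval 1 /
                  ((ascPochhammer ℝ n).eval (H + 1 / 2) *
                    (ascPochhammer ℝ n).eval (H + 1)) *
                (lam ^ 2 * s ^ 2 / 4) ^ n / (Nat.factorial n : ℝ)) := by
  obtain ⟨h0, h1⟩ := hH
  have hsm := summable15 H (lam ^ 2 * s ^ 2 / 4) h0 (by positivity)
  refine ⟨hsm, ?_⟩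
  set J : ℝ → ℝ := fun s => ∫ x in Set.Ioi (0:ℝ), Real.cos (s * x) * (x ^ (1 - 2 * H) / (lam ^ 2 + x ^ 2)) with hJ
  obtain ⟨hc, hA, hb, hV⟩ := volterra15 lam H hlam h0 h1 J (fun s => rfl)
  have hit := fun N => iter15 (J 0) _ lam H h0 J hc hb hV N s hs
  set B := Real.pi / (2 * Real.sin (Real.pi * H) * Real.Gamma (2 * H + 1)) with hB
  have hL : (∫ x : ℝ, Real.cos (s * x) * |x| ^ (1 - 2 * H) / (lam ^ 2 + x ^ 2)) = 2 * J s := by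
    rw [hJ, ← integral_comp_abs (f := fun x => Real.cos (s * x) * (x ^ (1 - 2 * H) / (lam ^ 2 + x ^ 2)))]
    congr 1
    ext x
    rw [sq_abs, mul_div_assoc]
    congr 1
    rcases abs_cases x with h | h <;> rw [h.1]
    rw [mul_neg, Real.cos_neg]
  have hsumT := ((Real.hasSum_cosh (lam * s)).mul_left (J 0)).sub (hsm.hasSum.mul_left (B * s ^ (2 * H)))
  have hTe : ∀ n : ℕ, T15 (J 0) B lam H n s = J 0 * ((lam * s) ^ (2 * n) / ((2 * n).factorial : ℝ)) -
      B * s ^ (2 * H) * ((ascPochhammer ℝ n).eval 1 /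
          ((ascPochhammer ℝ n).eval (H + 1 / 2) * (ascPochhammer ℝ n).eval (H + 1)) *
        (lam ^ 2 * s ^ 2 / 4) ^ n / (Nat.factorial n : ℝ)) := by
    intro n
    unfold T15
    have e : s ^ (2 * H + 2 * (n:ℝ)) = s ^ (2 * H) * (s ^ 2) ^ n := by
      rw [Real.rpow_add_of_nonneg hs (by positivity) (by positivity), ← pow_mul, ← Real.rpow_natCast s (2 * n)]
      push_cast; rfl
    have p1 := (ascPochhammer_pos n (H + 1/2) (by linarith)).ne'
    have p2 := (ascPochhammer_pos n (H + 1) (by linarith)).ne'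
    rw [e, ascPochhammer_eval_one, div_pow, mul_pow (lam ^ 2), pow_mul lam 2 n]
    have f0 : ((n).factorial : ℝ) ≠ 0 := by positivity
    field_simp
  simp only [← hTe] at hsumT
  have hlim : Filter.Tendsto (fun N => ∑ k ∈ Finset.range N, T15 (J 0) B lam H k s) Filter.atTop (nhds (J s)) := by
    rw [tendsto_iff_norm_sub_tendsto_zero]
    have hz : Filter.Tendsto (fun N : ℕ => J 0 * (lam * s) ^ (2 * N) / (Nat.factorial (2 * N) : ℝ)) Filter.atTop (nhds 0) := by
      have := ((FloorSemiring.tendsto_pow_div_factorial_atTop (lam * s)).comp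
        (Filter.tendsto_id.const_mul_atTop' (r := 2) (by norm_num))).const_mul (J 0)
      rw [mul_zero] at this
      refine this.congr fun N => ?_
      simp [mul_div_assoc]
    refine squeeze_zero (fun _ => norm_nonneg _) (fun N => ?_) hz
    rw [norm_sub_rev]
    exact hit N
  have hfin := tendsto_nhds_unique hlim hsumT.tendsto_sum_nat
  rw [hL, hfin, hA, hB]
  have hsin : 0 < Real.sin (Real.pi * H) := Real.sin_pos_of_pos_of_lt_pi (by positivity) (by nlinarith [Real.pi_pos])
  have hΓ : 0 < Real.Gamma (2 * H + 1) := Real.Gamma_pos_of_pos (by linarith)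
  field_simp
end
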